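/- Let X be a bounded, absolutely continuous ℝ^d-valued random variable with finite differential entropy, and let G be a standard Gaussian random vector in ℝ^d independent of X. Then H(X) = lim_{ε → 0⁺} H(X + εG). -/

import Mathlib

open MeasureTheory ProbabilityTheory

/-- Convolution of two measures on an additive monoid: the law of the sum of two independent
random variables with these laws. -/
noncomputable def mconv {E : Type*} [MeasurableSpace E] [Add E] (μ ν : Measure E) : Measure E :=
  (μ.prod ν).map (fun p => p.1 + p.2)

/-- The differential entropy (base 2) `H(μ) = -∫ f log₂ f` of a measure `μ` with density `f`
with respect to Lebesgue measure (junk value if `μ` is not absolutely continuous or the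
integrand is not integrable). -/
noncomputable def diffEnt {E : Type*} [MeasureSpace E] (μ : Measure E) : ℝ :=
  -∫ x, ((μ.rnDeriv volume x).toReal) * Real.logb 2 ((μ.rnDeriv volume x).toReal) ∂(volume : Measure E)

/-- `μ` is absolutely continuous with finite (i.e. well-defined) differential entropy. -/
def HasDiffEnt {E : Type*} [MeasureSpace E] (μ : Measure E) : Prop :=
  μ ≪ (volume : Measure E) ∧
    Integrable (fun x => ((μ.rnDeriv volume x).toReal) * Real.logb 2 ((μ.rnDeriv volume x).toReal))
      (volume : Measure E)

/-- The standard Gaussian measure on `ℝ^d`. -/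
noncomputable def stdGauss (d : ℕ) : Measure (Fin d → ℝ) :=
  Measure.pi (fun _ : Fin d => gaussianReal 0 1)

/-- The centered Gaussian measure on `ℝ^d` with covariance matrix `B·Bᵀ`, i.e. the law
of `G_B = B·G` for `G` standard Gaussian. -/
noncomputable def gaussMat {d : ℕ} (B : Matrix (Fin d) (Fin d) ℝ) : Measure (Fin d → ℝ) :=
  (stdGauss d).map (fun x => B.mulVec x)

/-- `H(X; B) = H(X + G_B) - H(G_B)` where `G_B` is an independent centered Gaussian vector
with covariance `B·Bᵀ`, expressed via the law `μ` of `X`. -/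
noncomputable def entAt {d : ℕ} (μ : Measure (Fin d → ℝ)) (B : Matrix (Fin d) (Fin d) ℝ) : ℝ :=
  diffEnt (mconv μ (gaussMat B)) - diffEnt (gaussMat B)

/-- `H(X; B₁ | B₂) = H(X; B₁) - H(X; B₂)`, expressed via the law `μ` of `X`. -/
noncomputable def entBetween {d : ℕ} (μ : Measure (Fin d → ℝ))
    (B₁ B₂ : Matrix (Fin d) (Fin d) ℝ) : ℝ :=
  entAt μ B₁ - entAt μ B₂

open Filter Topology
open scoped ENNReal

theorem fatou_tendsto {α : Type*} [MeasurableSpace α] {μ : Measure α} {F : ℕ → α → ℝ} {G : α → ℝ}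
    {c : ℕ → ℝ} (hF : ∀ n, Integrable (F n) μ) (hG : Integrable G μ)
    (hF0 : ∀ n, 0 ≤ᵐ[μ] F n) (hG0 : 0 ≤ᵐ[μ] G)
    (hlim : ∀ᵐ x ∂μ, Tendsto (fun n => F n x) atTop (𝓝 (G x)))
    (hle : ∀ n, ∫ x, F n x ∂μ ≤ ∫ x, G x ∂μ + c n) (hc : Tendsto c atTop (𝓝 0)) :
    Tendsto (fun n => ∫ x, F n x ∂μ) atTop (𝓝 (∫ x, G x ∂μ)) := by
  have hfat : ENNReal.ofReal (∫ x, G x ∂μ) ≤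
      liminf (fun n => ENNReal.ofReal (∫ x, F n x ∂μ)) atTop := by
    have h1 := lintegral_liminf_le' (μ := μ) (u := atTop)
      (f := fun n x => ENNReal.ofReal (F n x))
      (fun n => (hF n).aestronglyMeasurable.aemeasurable.ennreal_ofReal)
    simp_rw [ofReal_integral_eq_lintegral_ofReal hG hG0,
      fun n => ofReal_integral_eq_lintegral_ofReal (hF n) (hF0 n)]
    refine le_trans (le_of_eq ?_) h1
    refine lintegral_congr_ae ?_
    filter_upwards [hlim] with x hx
    exact (((ENNReal.continuous_ofReal.tendsto _).comp hx).liminf_eq).symm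
  rw [tendsto_order]
  constructor
  · intro a ha
    by_cases ha0 : a < 0
    · exact Eventually.of_forall fun n => ha0.trans_le (integral_nonneg_of_ae (hF0 n))
    · push Not at ha0
      have : ENNReal.ofReal a < liminf (fun n => ENNReal.ofReal (∫ x, F n x ∂μ)) atTop :=
        lt_of_lt_of_le ((ENNReal.ofReal_lt_ofReal_iff_of_nonneg ha0).2 ha) hfat
      filter_upwards [eventually_lt_of_lt_liminf this] with n hn
      exact (ENNReal.ofReal_lt_ofReal_iff_of_nonneg ha0).1 hn
  · intro a ha
    have : Tendsto (fun n => ∫ x, G x ∂μ + c n) atTop (𝓝 (∫ x, G x ∂μ + 0)) := hc.const_add _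
    rw [add_zero] at this
    filter_upwards [this.eventually_lt_const ha] with n hn
    exact (hle n).trans_lt hn

theorem shear_mp {d : ℕ} (γ : Measure (Fin d → ℝ)) [IsProbabilityMeasure γ] (ε : ℝ) :
    MeasurePreserving (fun p : (Fin d → ℝ) × (Fin d → ℝ) => (p.1 - ε • p.2, p.2))
      (volume.prod γ) (volume.prod γ) := by
  have h : MeasurePreserving (fun p : (Fin d → ℝ) × (Fin d → ℝ) => (p.1, p.2 - ε • p.1))
      (γ.prod volume) (γ.prod volume) :=
    MeasurePreserving.skew_product (g := fun x y => y - ε • x) (MeasurePreserving.id γ)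
      (by fun_prop) <| Eventually.of_forall fun x => map_sub_right_eq_self volume _
  exact Measure.measurePreserving_swap.comp (h.comp Measure.measurePreserving_swap)

theorem transl_tendsto {d : ℕ} {f : (Fin d → ℝ) → ℝ} (hf : Integrable f) :
    Tendsto (fun z : Fin d → ℝ => ∫⁻ x, ‖f (x - z) - f x‖ₑ) (𝓝 0) (𝓝 0) := by
  have hm : MemLp f 1 volume := memLp_one_iff_integrable.2 hf
  have mp : ∀ z : Fin d → ℝ, MeasurePreserving (fun x => -z + x) volume volume :=
    fun z => measurePreserving_add_left volume _
  have hc : Continuous (fun z : Fin d → ℝ =>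
      Lp.compMeasurePreserving (fun x => -z + x) (mp z) hm.toLp) := by
    let g : C(Fin d → ℝ, C(Fin d → ℝ, Fin d → ℝ)) :=
      (ContinuousMap.mk (fun a : (Fin d → ℝ) × (Fin d → ℝ) => -a.1 + a.2) (by fun_prop)).curry
    exact (continuous_const (y := hm.toLp)).compMeasurePreservingLp g.continuous mp (by simp)
  have h0 := (hc.edist (continuous_const (y := hm.toLp))).tendsto 0
  have e : ∀ z : Fin d → ℝ, edist (Lp.compMeasurePreserving (fun x => -z + x) (mp z) hm.toLp) hm.toLp
      = ∫⁻ x, ‖f (x - z) - f x‖ₑ := by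
    intro z
    rw [Lp.edist_def, eLpNorm_one_eq_lintegral_enorm]
    refine lintegral_congr_ae ?_
    filter_upwards [Lp.coeFn_compMeasurePreserving hm.toLp (mp z), hm.coeFn_toLp,
      (mp z).quasiMeasurePreserving.ae_eq_comp hm.coeFn_toLp] with x h1 h2 h3
    simp only [Pi.sub_apply, h1, h2, Function.comp] at h3 ⊢
    rw [h3, neg_add_eq_sub]
  simp_rw [e] at h0
  simpa using h0

theorem int_exp_abs : Integrable (fun x : ℝ => Real.exp (-|x|)) := by
  have := (integrable_fun_norm_addHaar (volume : Measure ℝ) (f := fun x : ℝ => Real.exp (-x))).2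
    (by simpa using integrableOn_exp_neg_Ioi 0)
  simpa using this

/-- The `ℓ¹` norm. -/
noncomputable def lone {d : ℕ} (x : Fin d → ℝ) : ℝ := ∑ i, |x i|

theorem lone_nonneg {d : ℕ} (x : Fin d → ℝ) : 0 ≤ lone x :=
  Finset.sum_nonneg fun _ _ => abs_nonneg _

theorem lone_continuous {d : ℕ} : Continuous (lone (d := d)) := by
  unfold lone; fun_prop

theorem lone_le {d : ℕ} (x y : Fin d → ℝ) (ε : ℝ) : lone x ≤ lone (x - ε • y) + |ε| * lone y := by
  unfold lone
  rw [Finset.mul_sum, ← Finset.sum_add_distrib]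
  refine Finset.sum_le_sum fun i _ => ?_
  have := abs_add_le (x i - ε * y i) (ε * y i)
  simp only [Pi.sub_apply, Pi.smul_apply, smul_eq_mul]
  rw [← abs_mul]
  simpa using this

theorem int_exp_lone {d : ℕ} : Integrable (fun x : Fin d → ℝ => Real.exp (-lone x)) := by
  have := Integrable.fintype_prod (ι := Fin d) (f := fun _ x => Real.exp (-|x|))
    (μ := fun _ => (volume : Measure ℝ)) (fun _ => int_exp_abs)
  simp_rw [lone, ← Finset.sum_neg_distrib, Real.exp_sum]
  exact this

/-- The averaging operator `g ↦ E g(x - εG)`. -/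
noncomputable def avg {d : ℕ} (γ : Measure (Fin d → ℝ)) (ε : ℝ) (g : (Fin d → ℝ) → ℝ)
    (x : Fin d → ℝ) : ℝ := ∫ y, g (x - ε • y) ∂γ

section
variable {d : ℕ} (γ : Measure (Fin d → ℝ)) [IsProbabilityMeasure γ]

theorem shear_int {g : (Fin d → ℝ) → ℝ} (hg : Integrable g) (ε : ℝ) :
    Integrable (fun p : (Fin d → ℝ) × (Fin d → ℝ) => g (p.1 - ε • p.2)) (volume.prod γ) :=
  (shear_mp γ ε).integrable_comp_of_integrable (hg.comp_fst γ)

theorem avg_int {g : (Fin d → ℝ) → ℝ} (hg : Integrable g) (ε : ℝ) :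
    Integrable (avg γ ε g) := (shear_int γ hg ε).integral_prod_left

theorem avg_integral {g : (Fin d → ℝ) → ℝ} (hg : Integrable g) (ε : ℝ) :
    ∫ x, avg γ ε g x = ∫ x, g x := by
  unfold avg
  rw [integral_integral_swap (shear_int γ hg ε)]
  simp [integral_sub_right_eq_self]

theorem avg_lone {f : (Fin d → ℝ) → ℝ} (hf0 : ∀ x, 0 ≤ f x) (hf : Integrable f)
    (hsf : Integrable (fun x => lone x * f x)) (hγ : Integrable lone γ) (ε : ℝ) :
    Integrable (fun x => lone x * avg γ ε f x) ∧
    ∫ x, lone x * avg γ ε f x ≤ (∫ x, lone x * f x) + |ε| * ((∫ x, f x) * ∫ y, lone y ∂γ) := by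
  have h1 := shear_int γ hsf ε
  have h2' : Integrable (fun p : (Fin d → ℝ) × (Fin d → ℝ) => f p.1 * lone p.2) (volume.prod γ) :=
    hf.mul_prod hγ
  have h2 : Integrable (fun p : (Fin d → ℝ) × (Fin d → ℝ) => f (p.1 - ε • p.2) * lone p.2)
    (volume.prod γ) := (shear_mp γ ε).integrable_comp_of_integrable h2'
  have hle : ∀ p : (Fin d → ℝ) × (Fin d → ℝ), lone p.1 * f (p.1 - ε • p.2) ≤
      lone (p.1 - ε • p.2) * f (p.1 - ε • p.2) + |ε| * (f (p.1 - ε • p.2) * lone p.2) := by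
    intro p
    have := mul_le_mul_of_nonneg_right (lone_le p.1 p.2 ε) (hf0 (p.1 - ε • p.2))
    linarith
  have h3 := h1.add (h2.const_mul |ε|)
  have h4 : Integrable (fun p : (Fin d → ℝ) × (Fin d → ℝ) => lone p.1 * f (p.1 - ε • p.2))
      (volume.prod γ) := by
    refine h3.mono' ?_ (Eventually.of_forall fun p => ?_)
    · exact ((lone_continuous.comp continuous_fst).aestronglyMeasurable).mul
        (shear_int γ hf ε).aestronglyMeasurable
    · rw [Real.norm_of_nonneg (mul_nonneg (lone_nonneg _) (hf0 _))]
      exact hle p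
  have e : (fun x => lone x * avg γ ε f x) =
      fun x => ∫ y, lone x * f (x - ε • y) ∂γ := by
    funext x; rw [integral_const_mul]; rfl
  constructor
  · rw [e]; exact h4.integral_prod_left
  · rw [e, ← integral_prod (fun p : (Fin d → ℝ) × (Fin d → ℝ) => lone p.1 * f (p.1 - ε • p.2)) h4]
    refine (integral_mono h4 h3 hle).trans (le_of_eq ?_)
    simp only [Pi.add_apply]
    rw [integral_add h1 (h2.const_mul |ε|), integral_const_mul]
    congr 1
    · rw [integral_prod _ h1]; exact avg_integral γ hsf ε
    · congr 1
      rw [integral_prod_symm _ h2, mul_comm (∫ x, f x), ← integral_mul_const]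
      refine integral_congr_ae (Eventually.of_forall fun y => ?_)
      simp only
      rw [integral_mul_const, integral_sub_right_eq_self f (ε • y), mul_comm]

theorem avg_tendsto {f : (Fin d → ℝ) → ℝ} (hfm : Measurable f) (hf : Integrable f) :
    Tendsto (fun ε : ℝ => eLpNorm (avg γ ε f - f) 1 volume) (𝓝 0) (𝓝 0) := by
  have hmeas : ∀ ε : ℝ, Measurable (fun p : (Fin d → ℝ) × (Fin d → ℝ) =>
      ‖f (p.1 - ε • p.2) - f p.1‖ₑ) := by intro ε; fun_prop
  have hb : ∀ ε : ℝ, eLpNorm (avg γ ε f - f) 1 volume ≤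
      ∫⁻ y, ∫⁻ x, ‖f (x - ε • y) - f x‖ₑ ∂volume ∂γ := by
    intro ε
    rw [eLpNorm_one_eq_lintegral_enorm, ← lintegral_lintegral_swap (hmeas ε).aemeasurable]
    refine lintegral_mono_ae ?_
    filter_upwards [(shear_int γ hf ε).prod_right_ae] with x hx
    have : (avg γ ε f - f) x = ∫ y, (f (x - ε • y) - f x) ∂γ := by
      rw [integral_sub hx (integrable_const _)]; simp [avg]
    rw [this]
    exact enorm_integral_le_lintegral_enorm _
  refine tendsto_of_tendsto_of_tendsto_of_le_of_le tendsto_const_nhds ?_ (fun _ => zero_le) hb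
  have key := tendsto_lintegral_filter_of_dominated_convergence (μ := γ) (l := 𝓝 (0 : ℝ))
    (F := fun ε y => ∫⁻ x, ‖f (x - ε • y) - f x‖ₑ ∂volume) (f := fun _ => 0)
    (fun _ => 2 * ∫⁻ x, ‖f x‖ₑ)
    (Eventually.of_forall fun ε => (hmeas ε).lintegral_prod_left') ?_ ?_ ?_
  · simpa using key
  · refine Eventually.of_forall fun ε => Eventually.of_forall fun y => ?_
    calc ∫⁻ x, ‖f (x - ε • y) - f x‖ₑ ≤ ∫⁻ x, (‖f (x - ε • y)‖ₑ + ‖f x‖ₑ) :=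
          lintegral_mono fun x => enorm_sub_le
      _ = 2 * ∫⁻ x, ‖f x‖ₑ := by
          rw [lintegral_add_right _ (by fun_prop),
            lintegral_sub_right_eq_self (fun x => ‖f x‖ₑ) (ε • y), two_mul]
  · have := hf.hasFiniteIntegral
    rw [HasFiniteIntegral] at this
    simp only [lintegral_const, measure_univ, mul_one]
    exact (ENNReal.mul_lt_top (by simp) this).ne
  · refine Eventually.of_forall fun y => ?_
    refine (transl_tendsto hf).comp ?_
    have : Continuous fun ε : ℝ => ε • y := by fun_prop
    simpa using this.tendsto 0

theorem gibbs_nonneg {t s : ℝ} (ht : 0 ≤ t) :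
    0 ≤ t * Real.log t + s * t - t + Real.exp (-s) := by
  rcases ht.eq_or_lt with rfl | ht'
  · simp [Real.exp_nonneg]
  have h := InformationTheory.klFun_nonneg (x := t * Real.exp s) (by positivity)
  rw [InformationTheory.klFun_apply, Real.log_mul ht'.ne' (Real.exp_ne_zero _), Real.log_exp] at h
  have h2 := mul_nonneg h (Real.exp_nonneg (-s))
  have h3 : Real.exp s * Real.exp (-s) = 1 := by rw [← Real.exp_add]; simp
  have : (t * Real.exp s * (Real.log t + s) + 1 - t * Real.exp s) * Real.exp (-s)
    = t * (Real.log t + s) * (Real.exp s * Real.exp (-s)) + Real.exp (-s)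
      - t * (Real.exp s * Real.exp (-s)) := by ring
  rw [this, h3] at h2
  linarith

theorem integral_four {a b c e : (Fin d → ℝ) → ℝ} (ha : Integrable a) (hb : Integrable b)
    (hc : Integrable c) (he : Integrable e) :
    ∫ x, (a x + b x - c x + e x) = (∫ x, a x) + (∫ x, b x) - (∫ x, c x) + ∫ x, e x := by
  have h1 : Integrable (fun x => a x + b x) := ha.add hb
  have h2 : Integrable (fun x => a x + b x - c x) := h1.sub hc
  rw [integral_add h2 he, integral_sub h1 hc, integral_add ha hb]

theorem main_tendsto {f : (Fin d → ℝ) → ℝ} (hfm : Measurable f) (hf0 : ∀ x, 0 ≤ f x)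
    (hf : Integrable f) (hψ : Integrable (fun x => f x * Real.log (f x)))
    (hsf : Integrable (fun x => lone x * f x)) (hγ : Integrable lone γ) :
    Tendsto (fun ε : ℝ => ∫ x, avg γ ε f x * Real.log (avg γ ε f x)) (𝓝 0)
      (𝓝 (∫ x, f x * Real.log (f x))) := by
  have ha0 : ∀ ε x, 0 ≤ avg γ ε f x := fun ε x => integral_nonneg fun y => hf0 _
  -- Jensen
  have hJ : ∀ ε : ℝ, ∀ᵐ x, avg γ ε f x * Real.log (avg γ ε f x) ≤
      avg γ ε (fun x => f x * Real.log (f x)) x := by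
    intro ε
    filter_upwards [(shear_int γ hf ε).prod_right_ae, (shear_int γ hψ ε).prod_right_ae] with x h1 h2
    exact Real.convexOn_mul_log.map_integral_le Real.continuous_mul_log.continuousOn isClosed_Ici
      (Eventually.of_forall fun y => hf0 _) h1 h2
  have hlow : ∀ ε : ℝ, Integrable (fun x => avg γ ε f x - lone x * avg γ ε f x
      - Real.exp (-lone x)) := fun ε =>
    ((avg_int γ hf ε).sub (avg_lone γ hf0 hf hsf hγ ε).1).sub int_exp_lone
  have hint : ∀ ε : ℝ, Integrable (fun x => avg γ ε f x * Real.log (avg γ ε f x)) := by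
    intro ε
    refine integrable_of_le_of_le (g₁ := fun x => avg γ ε f x - lone x * avg γ ε f x
      - Real.exp (-lone x)) (g₂ := avg γ ε (fun x => f x * Real.log (f x))) ?_ ?_ (hJ ε) (hlow ε)
      (avg_int γ hψ ε)
    · exact Real.continuous_mul_log.comp_aestronglyMeasurable (avg_int γ hf ε).aestronglyMeasurable
    · refine Eventually.of_forall fun x => ?_
      have := gibbs_nonneg (s := lone x) (ha0 ε x)
      simp only; linarith
  have hup : ∀ ε : ℝ, ∫ x, avg γ ε f x * Real.log (avg γ ε f x) ≤ ∫ x, f x * Real.log (f x) := by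
    intro ε
    rw [← avg_integral γ hψ ε]
    exact integral_mono_ae (hint ε) (avg_int γ hψ ε) (hJ ε)
  set m := (∫ x, f x) * ∫ y, lone y ∂γ with hm
  have hFint : ∀ ε : ℝ, Integrable (fun x => avg γ ε f x * Real.log (avg γ ε f x)
      + lone x * avg γ ε f x - avg γ ε f x + Real.exp (-lone x)) := fun ε =>
    (((hint ε).add (avg_lone γ hf0 hf hsf hγ ε).1).sub (avg_int γ hf ε)).add int_exp_lone
  have hGint : Integrable (fun x => f x * Real.log (f x) + lone x * f x - f x
      + Real.exp (-lone x)) := ((hψ.add hsf).sub hf).add int_exp_lone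
  have hFval : ∀ ε : ℝ, ∫ x, (avg γ ε f x * Real.log (avg γ ε f x)
      + lone x * avg γ ε f x - avg γ ε f x + Real.exp (-lone x)) =
      (∫ x, avg γ ε f x * Real.log (avg γ ε f x)) + (∫ x, lone x * avg γ ε f x) - (∫ x, f x)
        + ∫ x : Fin d → ℝ, Real.exp (-lone x) := by
    intro ε
    rw [← avg_integral γ hf ε]
    exact integral_four (hint ε) (avg_lone γ hf0 hf hsf hγ ε).1 (avg_int γ hf ε) int_exp_lone
  have hGval : ∫ x, (f x * Real.log (f x) + lone x * f x - f x + Real.exp (-lone x)) =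
      (∫ x, f x * Real.log (f x)) + (∫ x, lone x * f x) - (∫ x, f x)
        + ∫ x : Fin d → ℝ, Real.exp (-lone x) :=
    integral_four hψ hsf hf int_exp_lone
  refine tendsto_of_subseq_tendsto fun es hes => ?_
  have hM : TendstoInMeasure volume (fun n => avg γ (es n) f) atTop f :=
    tendstoInMeasure_of_tendsto_eLpNorm one_ne_zero
      (fun n => (avg_int γ hf _).aestronglyMeasurable) hf.aestronglyMeasurable
      ((avg_tendsto γ hfm hf).comp hes)
  obtain ⟨ns, hns, hae⟩ := hM.exists_seq_tendsto_ae
  refine ⟨ns, ?_⟩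
  have hes' : Tendsto (fun n => es (ns n)) atTop (𝓝 0) := hes.comp hns.tendsto_atTop
  have hcm : Tendsto (fun n => |es (ns n)| * m) atTop (𝓝 0) := by
    simpa using (hes'.abs.mul_const m)
  have hfat := fatou_tendsto (c := fun n => |es (ns n)| * m) (fun n => hFint (es (ns n))) hGint
    (fun n => Eventually.of_forall fun x => gibbs_nonneg (ha0 _ _))
    (Eventually.of_forall fun x => gibbs_nonneg (hf0 _)) ?_ ?_ hcm
  · have hlo : Tendsto (fun n => (∫ x, (avg γ (es (ns n)) f x * Real.log (avg γ (es (ns n)) f x)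
      + lone x * avg γ (es (ns n)) f x - avg γ (es (ns n)) f x + Real.exp (-lone x)))
      - (∫ x, (f x * Real.log (f x) + lone x * f x - f x + Real.exp (-lone x)))
      - |es (ns n)| * m + ∫ x, f x * Real.log (f x)) atTop (𝓝 (∫ x, f x * Real.log (f x))) := by
      simpa using ((hfat.sub_const (∫ x, (f x * Real.log (f x) + lone x * f x - f x + Real.exp (-lone x)))).sub hcm).add_const (∫ x, f x * Real.log (f x))
    refine tendsto_of_tendsto_of_tendsto_of_le_of_le hlo tendsto_const_nhds (fun n => ?_)
      (fun n => hup _)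
    have := (avg_lone γ hf0 hf hsf hγ (es (ns n))).2
    simp only [hFval, hGval]
    linarith
  · filter_upwards [hae] with x hx
    have := (Real.continuous_mul_log.tendsto _).comp hx
    exact ((this.add (hx.const_mul (lone x))).sub hx).add_const _
  · intro n
    have := (avg_lone γ hf0 hf hsf hγ (es (ns n))).2
    have := hup (es (ns n))
    simp only [hFval, hGval]
    linarith

end

theorem mconv_eq {d : ℕ} (γ : Measure (Fin d → ℝ)) [IsProbabilityMeasure γ]
    {f : (Fin d → ℝ) → ℝ} (hfm : Measurable f) (hf0 : ∀ x, 0 ≤ f x) (hf : Integrable f) (ε : ℝ)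
    (μ : Measure (Fin d → ℝ)) [IsProbabilityMeasure μ]
    (hμ : μ = volume.withDensity (fun x => ENNReal.ofReal (f x))) :
    mconv μ (γ.map (fun x => ε • x)) =
      volume.withDensity (fun x => ENNReal.ofReal (avg γ ε f x)) := by
  have hsm : Measurable (fun x : Fin d → ℝ => ε • x) := by fun_prop
  have : IsProbabilityMeasure (γ.map (fun x => ε • x)) :=
    Measure.isProbabilityMeasure_map hsm.aemeasurable
  ext s hs
  have hadd : Measurable (fun p : (Fin d → ℝ) × (Fin d → ℝ) => p.1 + p.2) := by fun_prop
  have hind : Measurable (s.indicator (1 : (Fin d → ℝ) → ℝ≥0∞)) := measurable_one.indicator hs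
  have hF : Measurable (fun p : (Fin d → ℝ) × (Fin d → ℝ) =>
      s.indicator (1 : (Fin d → ℝ) → ℝ≥0∞) (p.1 + p.2)) := hind.comp hadd
  rw [mconv, ← lintegral_indicator_one hs, lintegral_map hind hadd,
    lintegral_prod_symm' _ hF, lintegral_map hF.lintegral_prod_left' hsm]
  have e1 : ∀ y : Fin d → ℝ, ∫⁻ x, s.indicator 1 (x + ε • y) ∂μ =
      ∫⁻ x, ENNReal.ofReal (f (x - ε • y)) * s.indicator 1 x := by
    intro y
    have hy : Measurable (fun x : Fin d → ℝ =>
        s.indicator (1 : (Fin d → ℝ) → ℝ≥0∞) (x + ε • y)) :=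
      hind.comp (measurable_id.add_const _)
    rw [hμ, lintegral_withDensity_eq_lintegral_mul _ hfm.ennreal_ofReal hy,
      ← lintegral_sub_right_eq_self _ (ε • y)]
    simp
  simp_rw [e1]
  rw [lintegral_lintegral_swap (by
    refine Measurable.aemeasurable ?_
    refine Measurable.mul ?_ (hind.comp measurable_snd)
    fun_prop)]
  rw [withDensity_apply _ hs, ← lintegral_indicator hs]
  refine lintegral_congr_ae ?_
  filter_upwards [(shear_int γ hf ε).prod_right_ae] with x hx
  rw [lintegral_mul_const _ (by fun_prop)]
  unfold avg
  by_cases hxs : x ∈ s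
  · simp only [hxs, Set.indicator_of_mem, Pi.one_apply, mul_one]
    exact (ofReal_integral_eq_lintegral_ofReal hx (Eventually.of_forall fun y => hf0 _)).symm
  · simp [hxs]

theorem diffEnt_withDensity {d : ℕ} {g : (Fin d → ℝ) → ℝ} (hg : Integrable g) (hg0 : ∀ x, 0 ≤ g x) :
    diffEnt (volume.withDensity (fun x => ENNReal.ofReal (g x))) =
      -((∫ x, g x * Real.log (g x)) / Real.log 2) := by
  rw [diffEnt, ← integral_div]
  congr 1
  refine integral_congr_ae ?_
  filter_upwards [Measure.rnDeriv_withDensity₀ volume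
    hg.aestronglyMeasurable.aemeasurable.ennreal_ofReal] with x hx
  rw [hx, ENNReal.toReal_ofReal (hg0 x), Real.logb, mul_div_assoc]

theorem lone_int_gauss (d : ℕ) : Integrable lone (stdGauss d) := by
  unfold lone stdGauss
  refine integrable_finsetSum _ fun i _ => ?_
  have h : Integrable (fun x : ℝ => |x|) (gaussianReal 0 1) :=
    ((memLp_id_gaussianReal 1).integrable (by simp)).abs
  exact (measurePreserving_eval (fun _ : Fin d => gaussianReal 0 1) i).integrable_comp_of_integrable h

/-- If `X` is a bounded absolutely continuous `ℝ^d`-valued random variable with finite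
differential entropy and `G` is an independent standard Gaussian vector, then
`H(X) = lim_{ε→0⁺} H(X + εG)`. (The law of `X + εG` is the convolution of the law of `X`
with the law of `εG`.) -/
theorem stmt9 {d : ℕ} {Ω : Type*} [MeasurableSpace Ω] (P : Measure Ω) [IsProbabilityMeasure P]
    (X : Ω → (Fin d → ℝ)) (hX : Measurable X) (hXbdd : ∃ C : ℝ, ∀ ω, ‖X ω‖ ≤ C)
    (hent : HasDiffEnt (P.map X)) :
    Filter.Tendsto
      (fun ε : ℝ => diffEnt (mconv (P.map X) ((stdGauss d).map (fun x => ε • x))))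
      (nhdsWithin 0 (Set.Ioi 0)) (nhds (diffEnt (P.map X))) := by
  have hμp : IsProbabilityMeasure (P.map X) := Measure.isProbabilityMeasure_map hX.aemeasurable
  have hlone : Integrable lone (P.map X) := by
    obtain ⟨C, hC⟩ := hXbdd
    rw [integrable_map_measure lone_continuous.aestronglyMeasurable hX.aemeasurable]
    refine Integrable.of_bound ((lone_continuous.measurable.comp hX).aestronglyMeasurable)
      (d * C) (Eventually.of_forall fun ω => ?_)
    rw [Function.comp, Real.norm_of_nonneg (lone_nonneg _), lone]
    calc ∑ i, |X ω i| ≤ ∑ _i : Fin d, C :=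
          Finset.sum_le_sum fun i _ => (norm_le_pi_norm (X ω) i).trans (hC ω)
      _ = d * C := by simp
  generalize P.map X = μ at *
  obtain ⟨hac, hint⟩ := hent
  have : IsProbabilityMeasure (stdGauss d) := by unfold stdGauss; infer_instance
  set f : (Fin d → ℝ) → ℝ := fun x => (μ.rnDeriv volume x).toReal with hfdef
  have hfm : Measurable f := (Measure.measurable_rnDeriv _ _).ennreal_toReal
  have hf0 : ∀ x, 0 ≤ f x := fun x => ENNReal.toReal_nonneg
  have hf : Integrable f := Measure.integrable_toReal_rnDeriv
  have hμ : μ = volume.withDensity (fun x => ENNReal.ofReal (f x)) := by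
    conv_lhs => rw [← Measure.withDensity_rnDeriv_eq μ volume hac]
    refine withDensity_congr_ae ?_
    filter_upwards [Measure.rnDeriv_lt_top μ volume] with x hx
    exact (ENNReal.ofReal_toReal hx.ne).symm
  have hψ : Integrable (fun x => f x * Real.log (f x)) := by
    have := hint.mul_const (Real.log 2)
    refine this.congr (Eventually.of_forall fun x => ?_)
    have h2 : Real.log 2 ≠ 0 := (Real.log_pos one_lt_two).ne'
    simp only [Real.logb, hfdef]
    field_simp
  have hsf : Integrable (fun x => lone x * f x) := by
    have := (integrable_rnDeriv_smul_iff hac).2 hlone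
    refine this.congr (Eventually.of_forall fun x => ?_)
    simp [hfdef, mul_comm]
  have key := main_tendsto (stdGauss d) hfm hf0 hf hψ hsf (lone_int_gauss d)
  have e0 : diffEnt μ = -((∫ x, f x * Real.log (f x)) / Real.log 2) := by
    conv_lhs => rw [hμ]
    exact diffEnt_withDensity hf hf0
  have e1 : ∀ ε : ℝ, diffEnt (mconv μ ((stdGauss d).map (fun x => ε • x))) =
      -((∫ x, avg (stdGauss d) ε f x * Real.log (avg (stdGauss d) ε f x)) / Real.log 2) := by
    intro ε
    rw [mconv_eq (stdGauss d) hfm hf0 hf ε μ hμ]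
    exact diffEnt_withDensity (avg_int _ hf ε) (fun x => integral_nonneg fun y => hf0 _)
  simp_rw [e1]
  rw [e0]
  exact ((key.div_const _).neg).mono_left nhdsWithin_le_nhds
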